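/- Let K be a field with an additive valuation v : K → ℝ∞, let I ⊆ K[x_1,…,x_n] be a weight-homogeneous ideal with respect to weights a_1,…,a_n ∈ ℤ^m, and let Z := {w ∈ X^an : μ(0,w) = w}. Then Z is a strong deformation retract of X^an: there exists a continuous map H : X^an × [0,1] → X^an such that H(w,1) = w for all w ∈ X^an, H(w,0) = μ(0,w) for all w ∈ X^an, and H(w,r) = w for all w ∈ Z and all r ∈ [0,1]. -/

import Mathlib

open scoped Classical

noncomputable section

/-- `ℝ∞ = ℝ ∪ {∞}`, with the order topology. -/
abbrev RInf := WithTop ℝ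

noncomputable instance : TopologicalSpace RInf := Preorder.topology RInf
instance : OrderTopology RInf := ⟨rfl⟩

/-- An additive (non-Archimedean) valuation on a commutative ring, with values in
`ℝ∞`: `w(ab) = w(a) + w(b)`, `w(a+b) ≥ min (w a) (w b)`, `w 1 = 0`, `w 0 = ∞`. -/
structure IsVal {R : Type*} [CommRing R] (w : R → RInf) : Prop where
  map_mul : ∀ a b, w (a * b) = w a + w b
  min_le_add : ∀ a b, min (w a) (w b) ≤ w (a + b)
  map_one : w 1 = 0
  map_zero : w 0 = ⊤

/-- The analytification of `Spec B`: the set of additive valuations on the `K`-algebra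
`B` extending the valuation `v` on `K`, as a subset of the product space `B → ℝ∞`
(topology of pointwise convergence). -/
def An {K : Type*} [Field K] (v : K → RInf) (B : Type*) [CommRing B] [Algebra K B] :
    Set (B → RInf) :=
  {w | IsVal w ∧ ∀ c : K, w (algebraMap K B c) = v c}

variable {K : Type*} [Field K] {ι M : Type*} [Fintype M]

/-- Weight of a monomial exponent `α` with respect to weight vectors `a`. -/
def wt (a : ι → M → ℤ) (α : ι →₀ ℕ) : M → ℤ :=
  α.sum fun i k => (k : ℤ) • a i

/-- The weight-`β` component `F_β` of a polynomial `F`: the sum of the terms `c·x^α`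
of `F` with `Σ_i α_i a_i = β`. -/
def wtComp (a : ι → M → ℤ) (F : MvPolynomial ι K) (β : M → ℤ) : MvPolynomial ι K :=
  ∑ α ∈ F.support.filter (fun α => wt a α = β), MvPolynomial.monomial α (F.coeff α)

/-- An ideal is weight-homogeneous if it contains all weight components of its
members. -/
def WtHomog (a : ι → M → ℤ) (I : Ideal (MvPolynomial ι K)) : Prop :=
  ∀ F ∈ I, ∀ β : M → ℤ, wtComp a F β ∈ I

/-- Pairing `β·τ` of an integer vector with a real vector. -/
def pairR (β : M → ℤ) (τ : M → ℝ) : ℝ := ∑ j, (β j : ℝ) * τ j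

/-- `ν(F) = min_β (w(F̄_β) + β·τ)`: the minimum over the finitely many `β` with
`F_β ≠ 0`, with value `∞` for `F = 0`. -/
def muAux (a : ι → M → ℤ) (I : Ideal (MvPolynomial ι K))
    (w : (MvPolynomial ι K ⧸ I) → RInf) (τ : M → ℝ) (F : MvPolynomial ι K) : RInf :=
  (F.support.image (wt a)).inf fun β =>
    w (Ideal.Quotient.mk I (wtComp a F β)) + ((pairR β τ : ℝ) : RInf)

/-- `μ(τ,w) : B → ℝ∞`, computed on an arbitrary lift of `f` (for weight-homogeneous
`I` this is independent of the lift). -/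
def mu (a : ι → M → ℤ) (I : Ideal (MvPolynomial ι K)) (τ : M → ℝ)
    (w : (MvPolynomial ι K ⧸ I) → RInf) : (MvPolynomial ι K ⧸ I) → RInf :=
  fun f => muAux a I w τ (Function.surjInv Ideal.Quotient.mk_surjective f)

/-- The tropicalisation map `X^an → ℝ∞^ι`, `w ↦ (w(x̄_i))_i`. -/
def tropMap (I : Ideal (MvPolynomial ι K)) (w : (MvPolynomial ι K ⧸ I) → RInf) :
    ι → RInf :=
  fun i => w (Ideal.Quotient.mk I (MvPolynomial.X i))

/-- `Trop(X)`: the image of the analytification under `trop`, inside `ℝ∞^ι`. -/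
def TropSet (v : K → RInf) (I : Ideal (MvPolynomial ι K)) : Set (ι → RInf) :=
  {η | ∃ w ∈ An v (MvPolynomial ι K ⧸ I), tropMap I w = η}

/-- `Trop(X⁰)`: the points of `Trop(X)` with all coordinates finite, inside `ℝ^ι`. -/
def TropSet0 (v : K → RInf) (I : Ideal (MvPolynomial ι K)) : Set (ι → ℝ) :=
  {ξ | ∃ w ∈ An v (MvPolynomial ι K ⧸ I), ∀ i, tropMap I w i = ((ξ i : ℝ) : RInf)}

end

namespace IsVal

variable {R S : Type*} [CommRing R] [CommRing S] {w : R → RInf}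

theorem comp (hw : IsVal w) (f : S →+* R) : IsVal fun x => w (f x) where
  map_mul a b := by rw [_root_.map_mul, hw.map_mul]
  min_le_add a b := by rw [_root_.map_add]; exact hw.min_le_add _ _
  map_one := by rw [_root_.map_one, hw.map_one]
  map_zero := by rw [_root_.map_zero, hw.map_zero]

theorem lt_add (hw : IsVal w) {c d : RInf} {x y : R} (hx : c < w x + d) (hy : c < w y + d) :
    c < w (x + y) + d :=
  calc c < min (w x + d) (w y + d) := lt_min hx hy
    _ = min (w x) (w y) + d := min_add_add_right _ _ _
    _ ≤ w (x + y) + d := by gcongr; exact hw.min_le_add x y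

theorem le_add (hw : IsVal w) {c d : RInf} {x y : R} (hx : c ≤ w x + d) (hy : c ≤ w y + d) :
    c ≤ w (x + y) + d :=
  calc c ≤ min (w x + d) (w y + d) := le_min hx hy
    _ = min (w x) (w y) + d := min_add_add_right _ _ _
    _ ≤ w (x + y) + d := by gcongr; exact hw.min_le_add x y

theorem lt_sum (hw : IsVal w) {ι : Type*} {t : Finset ι} {f : ι → R} {c d : RInf} (hc : c < ⊤)
    (h : ∀ i ∈ t, c < w (f i) + d) : c < w (∑ i ∈ t, f i) + d :=
  Finset.sum_induction f (fun x => c < w x + d) (fun _ _ => hw.lt_add)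
    (by simpa [hw.map_zero] using hc) h

theorem le_sum_add (hw : IsVal w) {ι : Type*} {t : Finset ι} {f : ι → R} {c d : RInf}
    (h : ∀ i ∈ t, c ≤ w (f i) + d) : c ≤ w (∑ i ∈ t, f i) + d :=
  Finset.sum_induction f (fun x => c ≤ w x + d) (fun _ _ => hw.le_add)
    (by simp [hw.map_zero]) h

theorem le_sum (hw : IsVal w) {ι : Type*} {t : Finset ι} {f : ι → R} {c : RInf}
    (h : ∀ i ∈ t, c ≤ w (f i)) : c ≤ w (∑ i ∈ t, f i) := by
  simpa using hw.le_sum_add (d := 0) (by simpa using h)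

theorem map_neg_one (hw : IsVal w) : w (-1) = 0 := by
  have h : w (-1) + w (-1) = 0 := by rw [← hw.map_mul]; simp [hw.map_one]
  induction hx : w (-1) using WithTop.recTopCoe with
  | top => simp [hx] at h
  | coe x =>
    rw [hx] at h
    norm_cast at h ⊢
    linarith

theorem map_neg (hw : IsVal w) (x : R) : w (-x) = w x := by
  rw [neg_eq_neg_one_mul, hw.map_mul, hw.map_neg_one, zero_add]

theorem map_pow_eq_zero (hw : IsVal w) {x : R} (hx : w x = 0) (k : ℕ) : w (x ^ k) = 0 := by
  induction k with
  | zero => simp [hw.map_one]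
  | succ k ih => simp [pow_succ, hw.map_mul, ih, hx]

theorem pow_nonneg (hw : IsVal w) {x : R} (hx : 0 ≤ w x) (k : ℕ) : 0 ≤ w (x ^ k) := by
  induction k with
  | zero => simp [hw.map_one]
  | succ k ih => rw [pow_succ, hw.map_mul]; exact add_nonneg ih hx

theorem prod_nonneg (hw : IsVal w) {ι : Type*} {t : Finset ι} {f : ι → R}
    (h : ∀ i ∈ t, 0 ≤ w (f i)) : 0 ≤ w (∏ i ∈ t, f i) :=
  Finset.prod_induction f (fun x => 0 ≤ w x)
    (fun _ _ ha hb => by rw [hw.map_mul]; exact add_nonneg ha hb) hw.map_one.ge h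

theorem prod_eq_zero (hw : IsVal w) {ι : Type*} {t : Finset ι} {f : ι → R}
    (h : ∀ i ∈ t, w (f i) = 0) : w (∏ i ∈ t, f i) = 0 :=
  Finset.prod_induction f (fun x => w x = 0)
    (fun _ _ ha hb => by rw [hw.map_mul, ha, hb, add_zero]) hw.map_one h

theorem map_unit_inv_eq_zero (hw : IsVal w) {u : Rˣ} (hu : w u = 0) : w (u⁻¹ : Rˣ) = 0 := by
  have h : w (u * (u⁻¹ : Rˣ)) = 0 := by rw [Units.mul_inv, hw.map_one]
  rwa [hw.map_mul, hu, zero_add] at h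

theorem map_unit_zpow_eq_zero (hw : IsVal w) {u : Rˣ} (hu : w u = 0) (k : ℤ) :
    w (u ^ k : Rˣ) = 0 := by
  cases k with
  | ofNat k => simpa using hw.map_pow_eq_zero hu k
  | negSucc k =>
    rw [zpow_negSucc]
    exact hw.map_unit_inv_eq_zero (by simpa using hw.map_pow_eq_zero hu (k + 1))

end IsVal

noncomputable section

section Gauss

open MvPolynomial

variable {R σ : Type*} [CommRing R]

/-- The Gauss valuation `Σ c_γ x^γ ↦ min_γ (w(c_γ) + |γ| s)`. -/
def gaussVal (w : R → RInf) (s : RInf) (P : MvPolynomial σ R) : RInf :=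
  P.support.inf fun γ => w (P.coeff γ) + γ.degree • s

variable {w : R → RInf} {s : RInf}

theorem le_gaussVal_iff (hw : IsVal w) {c : RInf} {P : MvPolynomial σ R} :
    c ≤ gaussVal w s P ↔ ∀ γ, c ≤ w (P.coeff γ) + γ.degree • s := by
  rw [gaussVal, Finset.le_inf_iff]
  refine ⟨fun h γ => ?_, fun h γ _ => h γ⟩
  by_cases hγ : γ ∈ P.support
  · exact h γ hγ
  · rw [notMem_support_iff.1 hγ, hw.map_zero, top_add]
    exact le_top

theorem gaussVal_le (hw : IsVal w) (P : MvPolynomial σ R) (γ : σ →₀ ℕ) :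
    gaussVal w s P ≤ w (P.coeff γ) + γ.degree • s :=
  (le_gaussVal_iff hw).1 le_rfl γ

theorem gaussVal_zero : gaussVal w s (0 : MvPolynomial σ R) = ⊤ := by
  simp [gaussVal]

theorem gaussVal_C (hw : IsVal w) (x : R) : gaussVal w s (C x : MvPolynomial σ R) = w x := by
  refine le_antisymm ?_ ((le_gaussVal_iff hw).2 fun γ => ?_)
  · simpa using gaussVal_le (s := s) hw (C x : MvPolynomial σ R) 0
  · rw [coeff_C]
    split_ifs with h
    · simp [← h]
    · simp [hw.map_zero]

theorem gaussVal_X (hw : IsVal w) (j : σ) : gaussVal w s (X j : MvPolynomial σ R) = s := by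
  refine le_antisymm ?_ ((le_gaussVal_iff hw).2 fun γ => ?_)
  · simpa [hw.map_one] using gaussVal_le (s := s) hw (X j : MvPolynomial σ R) (Finsupp.single j 1)
  · rw [coeff_X]
    split_ifs with h
    · simp [← h, hw.map_one]
    · simp [hw.map_zero]

theorem add_le_gaussVal_mul (hw : IsVal w) (P Q : MvPolynomial σ R) :
    gaussVal w s P + gaussVal w s Q ≤ gaussVal w s (P * Q) := by
  refine (le_gaussVal_iff hw).2 fun γ => ?_
  rw [coeff_mul]
  refine hw.le_sum_add fun x hx => ?_
  rw [← Finset.HasAntidiagonal.mem_antidiagonal.1 hx, hw.map_mul, map_add, add_nsmul,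
    add_add_add_comm]
  exact add_le_add (gaussVal_le hw _ _) (gaussVal_le hw _ _)

/-- The Gauss valuation is attained at a smallest exponent. -/
theorem exists_gaussVal_eq_and_lt (o : MonomialOrder σ) (hw : IsVal w) {P : MvPolynomial σ R}
    (hP : gaussVal w s P ≠ ⊤) :
    ∃ k, gaussVal w s P = w (P.coeff k) + k.degree • s ∧
      ∀ i, o.toSyn i < o.toSyn k → gaussVal w s P < w (P.coeff i) + i.degree • s := by
  have hne : P.support.Nonempty := by
    rw [Finset.nonempty_iff_ne_empty]
    rintro h
    simp [gaussVal, h] at hP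
  obtain ⟨k₀, -, hk₀⟩ := Finset.exists_mem_eq_inf P.support hne
    fun γ => w (P.coeff γ) + γ.degree • s
  obtain ⟨k, hk, hmin⟩ := WellFounded.has_min (InvImage.wf o.toSyn wellFounded_lt)
    {k | gaussVal w s P = w (P.coeff k) + k.degree • s} ⟨k₀, hk₀⟩
  exact ⟨k, hk, fun i hi => lt_of_le_of_ne (gaussVal_le hw P i) fun h => hmin i h hi⟩

theorem gaussVal_mul [LinearOrder σ] [WellFoundedGT σ] (hw : IsVal w) (P Q : MvPolynomial σ R) :
    gaussVal w s (P * Q) = gaussVal w s P + gaussVal w s Q := by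
  refine le_antisymm ?_ (add_le_gaussVal_mul hw P Q)
  by_cases hP : gaussVal w s P = ⊤
  · simp [hP]
  by_cases hQ : gaussVal w s Q = ⊤
  · simp [hQ]
  let o : MonomialOrder σ := MonomialOrder.lex
  obtain ⟨k, hk, hklt⟩ := exists_gaussVal_eq_and_lt o hw hP
  obtain ⟨l, hl, hllt⟩ := exists_gaussVal_eq_and_lt o hw hQ
  refine (gaussVal_le hw _ (k + l)).trans (not_lt.1 fun hlt => ?_)
  have hmem : (k, l) ∈ Finset.HasAntidiagonal.antidiagonal (k + l) := by simp
  have hrest : gaussVal w s P + gaussVal w s Q <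
      w (∑ x ∈ (Finset.HasAntidiagonal.antidiagonal (k + l)).erase (k, l),
        P.coeff x.1 * Q.coeff x.2) + (k + l).degree • s := by
    refine hw.lt_sum (WithTop.add_lt_top.2 ⟨lt_top_iff_ne_top.2 hP, lt_top_iff_ne_top.2 hQ⟩) ?_
    rintro ⟨i, j⟩ hx
    obtain ⟨hne, hij⟩ := Finset.mem_erase.1 hx
    have hij : i + j = k + l := Finset.HasAntidiagonal.mem_antidiagonal.1 hij
    rw [← hij, hw.map_mul, map_add, add_nsmul, add_add_add_comm]
    rcases lt_or_ge (o.toSyn i) (o.toSyn k) with h | h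
    · exact WithTop.add_lt_add_of_lt_of_le hQ (hklt i h) (gaussVal_le hw Q j)
    · refine WithTop.add_lt_add_of_le_of_lt hP (gaussVal_le hw P i) (hllt j ?_)
      rcases h.lt_or_eq with h | h
      · by_contra! hj
        have := add_lt_add_of_lt_of_le h hj
        rw [← map_add, ← map_add, hij] at this
        exact this.false
      · have hik : k = i := o.toSyn.injective h
        subst hik
        exact absurd (by rw [add_left_cancel hij]) hne
  have hsplit : P.coeff k * Q.coeff l = (P * Q).coeff (k + l) +
      -∑ x ∈ (Finset.HasAntidiagonal.antidiagonal (k + l)).erase (k, l),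
        P.coeff x.1 * Q.coeff x.2 := by
    rw [coeff_mul, ← Finset.add_sum_erase _ _ hmem]
    ring
  have hkl := hw.lt_add hlt (by rwa [hw.map_neg])
  rw [← hsplit, hw.map_mul, map_add, add_nsmul, add_add_add_comm, ← hk, ← hl] at hkl
  exact hkl.false

theorem isVal_gaussVal [LinearOrder σ] [WellFoundedGT σ] (hw : IsVal w) :
    IsVal (gaussVal w s : MvPolynomial σ R → RInf) where
  map_mul := gaussVal_mul hw
  min_le_add P Q := (le_gaussVal_iff hw).2 fun γ => by
    rw [coeff_add]
    exact hw.le_add ((min_le_left _ _).trans (gaussVal_le hw P γ))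
      ((min_le_right _ _).trans (gaussVal_le hw Q γ))
  map_one := by rw [← C_1, gaussVal_C hw, hw.map_one]
  map_zero := gaussVal_zero

theorem gaussVal_le_constantCoeff (hw : IsVal w) (P : MvPolynomial σ R) :
    gaussVal w s P ≤ w (constantCoeff P) := by
  simpa [constantCoeff_eq] using gaussVal_le (s := s) hw P 0

theorem gaussVal_top (hw : IsVal w) (P : MvPolynomial σ R) :
    gaussVal w ⊤ P = w (constantCoeff P) := by
  refine le_antisymm (gaussVal_le_constantCoeff hw P) ((le_gaussVal_iff hw).2 fun γ => ?_)
  by_cases hγ : γ = 0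
  · simp [hγ, constantCoeff_eq]
  · obtain ⟨k, hk⟩ := Nat.exists_eq_succ_of_ne_zero (mt (Finsupp.degree_eq_zero_iff γ).1 hγ)
    simp [hk, succ_nsmul]

theorem gaussVal_one_add_X [LinearOrder σ] [WellFoundedGT σ] (hw : IsVal w) (hs : 0 ≤ s)
    (j : σ) : gaussVal w s (1 + X j : MvPolynomial σ R) = 0 := by
  refine le_antisymm ?_ ?_
  · have h := gaussVal_le_constantCoeff (s := s) hw (1 + X j : MvPolynomial σ R)
    rwa [map_add, map_one, constantCoeff_X, add_zero, hw.map_one] at h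
  · have h := (isVal_gaussVal (σ := σ) (s := s) hw).min_le_add 1 (X j)
    rwa [gaussVal_X hw, (isVal_gaussVal hw).map_one, min_eq_left hs] at h

/-- Integral changes of variables do not decrease the Gauss valuation with `s = 0`. -/
theorem gaussVal_le_eval₂ (hw : IsVal w) {S : Type*} [CommRing S] {w' : S → RInf} (hw' : IsVal w')
    (f : R →+* S) (hf : ∀ x, w x ≤ w' (f x)) (g : σ → S) (hg : ∀ j, 0 ≤ w' (g j))
    (P : MvPolynomial σ R) : gaussVal w 0 P ≤ w' (eval₂ f g P) := by
  rw [eval₂_eq]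
  refine hw'.le_sum fun γ _ => ?_
  rw [hw'.map_mul]
  calc gaussVal w 0 P ≤ w (P.coeff γ) + 0 := by simpa using gaussVal_le (s := 0) hw P γ
    _ ≤ _ := add_le_add (hf _) (hw'.prod_nonneg fun j _ => hw'.pow_nonneg (hg j) _)

end Gauss

section Loc

variable {R L : Type*} [CommRing R] [CommRing L] [Algebra R L] (S : Submonoid R)
  [IsLocalization S L]

/-- Extension to the localization at `S` of a valuation that vanishes on `S`. -/
def locVal (w : R → RInf) (z : L) : RInf := w (IsLocalization.sec S z).1

variable {w : R → RInf}

theorem locVal_eq (hw : IsVal w) (hS : ∀ d ∈ S, w d = 0) {z : L} {x d : R} (hd : d ∈ S)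
    (h : z * algebraMap R L d = algebraMap R L x) :
    locVal S w z = w x := by
  have hsec := IsLocalization.sec_spec S z
  set y := IsLocalization.sec S z with hy
  have hxy : algebraMap R L (y.1 * d) = algebraMap R L (x * y.2) := by
    rw [map_mul, map_mul, ← hsec, ← h]
    ring
  obtain ⟨c, hc⟩ := (IsLocalization.eq_iff_exists S L).1 hxy
  have := congrArg w hc
  rwa [hw.map_mul, hw.map_mul, hw.map_mul, hw.map_mul, hS d hd, hS _ y.2.2, hS _ c.2, zero_add,
    zero_add, add_zero, add_zero] at this

theorem locVal_algebraMap (hw : IsVal w) (hS : ∀ d ∈ S, w d = 0) (x : R) :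
    locVal S w (algebraMap R L x) = w x :=
  locVal_eq S hw hS S.one_mem (by simp)

theorem isVal_locVal (hw : IsVal w) (hS : ∀ d ∈ S, w d = 0) : IsVal (locVal S w : L → RInf) where
  map_mul a b := by
    have ha := IsLocalization.sec_spec S a
    have hb := IsLocalization.sec_spec S b
    refine (locVal_eq S hw hS (S.mul_mem (IsLocalization.sec S a).2.2
      (IsLocalization.sec S b).2.2) ?_).trans (hw.map_mul _ _)
    rw [map_mul, map_mul, ← ha, ← hb]
    ring
  min_le_add a b := by
    have ha := IsLocalization.sec_spec S a
    have hb := IsLocalization.sec_spec S b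
    set p := IsLocalization.sec S a with hp
    set q := IsLocalization.sec S b with hq
    have hab : locVal S w (a + b) = w (p.1 * q.2 + q.1 * p.2) := by
      refine locVal_eq S hw hS (S.mul_mem p.2.2 q.2.2) ?_
      rw [map_add, map_mul, map_mul, map_mul, ← ha, ← hb]
      ring
    have h := hw.min_le_add (p.1 * q.2) (q.1 * p.2)
    rw [hw.map_mul, hw.map_mul, hS _ p.2.2, hS _ q.2.2, add_zero, add_zero] at h
    rwa [hab]
  map_one := by rw [← map_one (algebraMap R L), locVal_algebraMap S hw hS, hw.map_one]
  map_zero := by rw [← map_zero (algebraMap R L), locVal_algebraMap S hw hS, hw.map_zero]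

end Loc

section Top

theorem continuous_add_RInf : Continuous fun p : RInf × RInf => p.1 + p.2 := by
  let e : RInf → EReal := fun x => (x : WithBot RInf)
  have hemb : Topology.IsEmbedding e :=
    StrictMono.isEmbedding_of_ordConnected (f := e) WithBot.coe_strictMono
      (by change (Set.range ((↑) : RInf → WithBot RInf)).OrdConnected
          rw [WithBot.range_coe]; exact Set.ordConnected_Ioi)
  have hbot : ∀ x, e x ≠ ⊥ := fun x => WithBot.coe_ne_bot
  rw [hemb.continuous_iff, continuous_iff_continuousAt]
  intro p
  have h : ContinuousAt (fun q : EReal × EReal => q.1 + q.2) (e p.1, e p.2) :=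
    EReal.continuousAt_add (Or.inr (hbot _)) (Or.inl (hbot _))
  exact ContinuousAt.comp (f := fun p : RInf × RInf => (e p.1, e p.2)) h
    (hemb.continuous.prodMap hemb.continuous).continuousAt

instance : ContinuousAdd RInf := ⟨continuous_add_RInf⟩

theorem exists_continuous_RInf :
    ∃ f : unitInterval → RInf, Continuous f ∧ f 0 = 0 ∧ f 1 = ⊤ ∧ ∀ r, 0 ≤ f r := by
  let g : ENNReal → RInf := WithTop.map ((↑) : NNReal → ℝ)
  have hg : StrictMono g := WithTop.strictMono_map_iff.2 fun _ _ h => h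
  have hrange : Set.range g = Set.Ici 0 := by
    ext x
    constructor
    · rintro ⟨y, rfl⟩
      exact hg.monotone (zero_le (a := y))
    · intro hx
      induction x using WithTop.recTopCoe with
      | top => exact ⟨⊤, rfl⟩
      | coe x => exact ⟨ENNReal.ofNNReal ⟨x, WithTop.coe_le_coe.1 hx⟩, rfl⟩
  have hcont : Continuous g :=
    (hg.isEmbedding_of_ordConnected (by rw [hrange]; exact Set.ordConnected_Ici)).continuous
  refine ⟨fun r => g ((ENNReal.ofReal (1 - r))⁻¹ - 1), hcont.comp ?_, ?_, ?_, fun r => ?_⟩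
  · exact (ENNReal.continuous_sub_right 1).comp (ENNReal.continuous_ofReal.comp (by fun_prop)).inv
  · simp only [Set.Icc.coe_zero, sub_zero, ENNReal.ofReal_one, inv_one, tsub_self]
    rfl
  · simp only [Set.Icc.coe_one, sub_self, ENNReal.ofReal_zero, ENNReal.inv_zero]
    rfl
  · exact hg.monotone (zero_le (a := _))

theorem continuous_inf_RInf {T κ : Type*} [TopologicalSpace T] (t : Finset κ)
    {f : κ → T → RInf} (hf : ∀ k ∈ t, Continuous (f k)) :
    Continuous fun x => t.inf fun k => f k x :=
  Continuous.finset_inf_apply hf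

end Top

section Torus

theorem zpow_sum {G κ : Type*} [CommGroup G] (g : G) (t : Finset κ) (k : κ → ℤ) :
    g ^ ∑ i ∈ t, k i = ∏ i ∈ t, g ^ k i := by
  induction t using Finset.induction_on with
  | empty => simp
  | insert i t hi ih => rw [Finset.sum_insert hi, Finset.prod_insert hi, zpow_add, ih]

open MvPolynomial

variable (M B : Type*) [CommRing B]

/-- The submonoid generated by the coordinates `1 + T_j` of the torus centered at `1`. -/
def torusSubmonoid : Submonoid (MvPolynomial M B) :=
  Submonoid.closure (Set.range fun j => 1 + X j)

/-- The coordinate ring of the torus, as a localization of `B[T_j : j ∈ M]`. -/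
def TorusRing : Type _ := Localization (torusSubmonoid M B)

instance : CommRing (TorusRing M B) :=
  inferInstanceAs (CommRing (Localization (torusSubmonoid M B)))

instance : Algebra (MvPolynomial M B) (TorusRing M B) :=
  inferInstanceAs (Algebra (MvPolynomial M B) (Localization (torusSubmonoid M B)))

instance : IsLocalization (torusSubmonoid M B) (TorusRing M B) :=
  inferInstanceAs (IsLocalization (torusSubmonoid M B) (Localization (torusSubmonoid M B)))

variable {M B}

theorem one_add_X_mem (j : M) : (1 + X j : MvPolynomial M B) ∈ torusSubmonoid M B :=
  Submonoid.subset_closure ⟨j, rfl⟩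

/-- The coordinate `1 + T_j` of the torus as a unit. -/
def torusCoord (j : M) : (TorusRing M B)ˣ :=
  (IsLocalization.map_units (TorusRing M B)
    (⟨1 + X j, one_add_X_mem j⟩ : torusSubmonoid M B)).unit

theorem coe_torusCoord (j : M) : ((torusCoord j : (TorusRing M B)ˣ) : TorusRing M B) =
    algebraMap (MvPolynomial M B) (TorusRing M B) (1 + X j) :=
  rfl

/-- Evaluation at the unit of the torus. -/
def torusCounit : TorusRing M B →+* B :=
  IsLocalization.lift (M := torusSubmonoid M B) (g := constantCoeff) fun y => by
    have : torusSubmonoid M B ≤ (IsUnit.submonoid B).comap constantCoeff :=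
      Submonoid.closure_le.2 (by rintro _ ⟨j, rfl⟩; simp)
    exact this y.2

theorem torusCounit_algebraMap (P : MvPolynomial M B) :
    torusCounit (algebraMap (MvPolynomial M B) (TorusRing M B) P) = constantCoeff P :=
  IsLocalization.lift_eq _ P

variable [Fintype M]

/-- The character of the torus of weight `β`. -/
def torusChar (β : M → ℤ) : (TorusRing M B)ˣ := ∏ j, torusCoord j ^ β j

/-- The function `x t^β` on the torus. -/
def torusTerm (x : B) (β : M → ℤ) : TorusRing M B :=
  algebraMap (MvPolynomial M B) (TorusRing M B) (C x) * (torusChar β : (TorusRing M B)ˣ)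

theorem torusChar_wt {ι : Type*} (a : ι → M → ℤ) (α : ι →₀ ℕ) :
    (torusChar (wt a α) : (TorusRing M B)ˣ) = α.prod fun i k => torusChar (a i) ^ k := by
  simp only [torusChar, wt, Finsupp.prod, Finsupp.sum, Finset.sum_apply, Pi.smul_apply,
    smul_eq_mul, ← Finset.prod_pow]
  rw [Finset.prod_comm]
  refine Finset.prod_congr rfl fun j _ => ?_
  rw [zpow_sum]
  exact Finset.prod_congr rfl fun i _ => by rw [mul_comm, zpow_mul, zpow_natCast]

theorem torusCounit_torusChar (β : M → ℤ) :
    torusCounit ((torusChar β : (TorusRing M B)ˣ) : TorusRing M B) = 1 := by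
  have h : ∀ j, Units.map (torusCounit (M := M) (B := B)).toMonoidHom (torusCoord j) = 1 := by
    intro j
    ext
    simp [coe_torusCoord, torusCounit_algebraMap]
  have : Units.map (torusCounit (M := M) (B := B)).toMonoidHom (torusChar β) = 1 := by
    simp only [torusChar, map_prod, map_zpow]
    exact Finset.prod_eq_one fun j _ => by rw [h, one_zpow]
  simpa using congrArg Units.val this

variable [LinearOrder M] {w : B → RInf} {s : RInf}

theorem gaussVal_torusSubmonoid (hw : IsVal w) (hs : 0 ≤ s) (d : MvPolynomial M B)
    (hd : d ∈ torusSubmonoid M B) : gaussVal w s d = 0 := by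
  have hG := isVal_gaussVal (σ := M) (s := s) hw
  refine Submonoid.closure_induction (motive := fun d _ => gaussVal w s d = 0) ?_ hG.map_one ?_ hd
  · rintro _ ⟨j, rfl⟩
    exact gaussVal_one_add_X hw hs j
  · intro x y _ _ hx hy
    rw [hG.map_mul, hx, hy, add_zero]

/-- The Gauss valuation on the coordinate ring of the torus. -/
def torusVal (w : B → RInf) (s : RInf) : TorusRing M B → RInf :=
  locVal (torusSubmonoid M B) (gaussVal w s)

theorem isVal_torusVal (hw : IsVal w) (hs : 0 ≤ s) :
    IsVal (torusVal w s : TorusRing M B → RInf) :=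
  isVal_locVal _ (isVal_gaussVal hw) (gaussVal_torusSubmonoid hw hs)

theorem torusVal_algebraMap (hw : IsVal w) (hs : 0 ≤ s) (P : MvPolynomial M B) :
    torusVal w s (algebraMap _ (TorusRing M B) P) = gaussVal w s P :=
  locVal_algebraMap _ (isVal_gaussVal hw) (gaussVal_torusSubmonoid hw hs) P

theorem torusVal_torusChar (hw : IsVal w) (hs : 0 ≤ s) (β : M → ℤ) :
    torusVal w s ((torusChar β : (TorusRing M B)ˣ) : TorusRing M B) = 0 := by
  have hV := isVal_torusVal (M := M) hw hs
  rw [torusChar, Units.coe_prod]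
  refine hV.prod_eq_zero fun j _ => hV.map_unit_zpow_eq_zero ?_ _
  rw [coe_torusCoord, torusVal_algebraMap hw hs, gaussVal_one_add_X hw hs]

theorem constantCoeff_sec (hw : IsVal w) (z : TorusRing M B) :
    w (constantCoeff (IsLocalization.sec (torusSubmonoid M B) z).1) = w (torusCounit z) := by
  have h := congrArg torusCounit (IsLocalization.sec_spec (torusSubmonoid M B) z)
  have hd := gaussVal_torusSubmonoid hw le_top _ (IsLocalization.sec (torusSubmonoid M B) z).2.2
  rw [gaussVal_top hw] at hd
  rw [map_mul, torusCounit_algebraMap, torusCounit_algebraMap] at h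
  rw [← h, hw.map_mul, hd, add_zero]

theorem torusVal_le_counit (hw : IsVal w) (z : TorusRing M B) :
    torusVal w s z ≤ w (torusCounit z) :=
  (gaussVal_le_constantCoeff hw _).trans_eq (constantCoeff_sec hw z)

theorem torusVal_top (hw : IsVal w) (z : TorusRing M B) :
    torusVal w ⊤ z = w (torusCounit z) :=
  (gaussVal_top hw _).trans (constantCoeff_sec hw z)

theorem torusVal_zero_sum_le (hw : IsVal w) (t : Finset (M → ℤ)) (f : (M → ℤ) → B)
    {β : M → ℤ} (hβ : β ∈ t) :
    torusVal w 0 (∑ β ∈ t, torusTerm (f β) β) ≤ w (f β) := by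
  obtain ⟨N, hN⟩ : ∃ N : ℕ, ∀ β ∈ t, ∀ j, 0 ≤ β j + N := by
    refine ⟨∑ β ∈ t, ∑ j, (β j).natAbs, fun β hβ j => ?_⟩
    have h₁ : (β j).natAbs ≤ ∑ j, (β j).natAbs :=
      Finset.single_le_sum (f := fun j => (β j).natAbs) (fun _ _ => Nat.zero_le _)
        (Finset.mem_univ j)
    have h₂ := Finset.single_le_sum (f := fun β : M → ℤ => ∑ j, (β j).natAbs)
      (fun _ _ => Nat.zero_le _) hβ
    have h₃ := h₁.trans h₂
    omega
  let e : (M → ℤ) → M →₀ ℕ := fun β => Finsupp.equivFunOnFinite.symm fun j => (β j + N).toNat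
  have he : ∀ β ∈ t, ∀ j, (e β j : ℤ) = β j + N := fun β hβ j => Int.toNat_of_nonneg (hN β hβ j)
  let P : MvPolynomial M B := ∑ β ∈ t, C (f β) * ∏ j, (1 + X j) ^ e β j
  have hval : torusVal w 0
      (∑ β ∈ t, torusTerm (f β) β) = gaussVal w 0 P := by
    refine locVal_eq _ (isVal_gaussVal hw) (gaussVal_torusSubmonoid hw le_rfl)
      (d := ∏ j : M, (1 + X j) ^ N)
      (Submonoid.prod_mem _ fun j _ => Submonoid.pow_mem _ (one_add_X_mem j) N) ?_
    rw [map_sum, Finset.sum_mul]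
    refine Finset.sum_congr rfl fun γ hγ => ?_
    rw [torusTerm, map_mul, mul_assoc]
    congr 1
    have : torusChar γ * ∏ j, torusCoord j ^ N
        = ∏ j, (torusCoord j : (TorusRing M B)ˣ) ^ e γ j := by
      rw [torusChar, ← Finset.prod_mul_distrib]
      refine Finset.prod_congr rfl fun j _ => ?_
      rw [← zpow_natCast, ← zpow_natCast, he γ hγ, zpow_add]
    simpa [Units.coe_prod, coe_torusCoord, map_prod] using congrArg Units.val this
  have heval : eval₂ C (fun j => X j - 1) P = ∑ β ∈ t, monomial (e β) (f β) := by
    rw [← coe_eval₂Hom, map_sum]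
    refine Finset.sum_congr rfl fun γ _ => ?_
    rw [monomial_eq, Finsupp.prod_fintype _ _ (fun _ => pow_zero _)]
    simp [map_prod]
  have hcoeff : (∑ β ∈ t, monomial (e β) (f β)).coeff (e β) = f β := by
    rw [coeff_sum, Finset.sum_eq_single β]
    · simp
    · intro γ hγ hne
      rw [coeff_monomial, if_neg]
      intro h
      refine hne (funext fun j => ?_)
      have := he γ hγ j
      rw [h, he β hβ j] at this
      linarith
    · exact fun h => absurd hβ h
  have hG := isVal_gaussVal (σ := M) (s := 0) hw
  have hX : ∀ j : M, 0 ≤ gaussVal w 0 (X j - 1 : MvPolynomial M B) := by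
    intro j
    have h := hG.min_le_add (X j) (-1)
    rwa [gaussVal_X hw, hG.map_neg_one, min_self, ← sub_eq_add_neg] at h
  calc _ = gaussVal w 0 P := hval
    _ ≤ gaussVal w 0 (eval₂ C (fun j => X j - 1) P) :=
      gaussVal_le_eval₂ hw hG C (fun x => (gaussVal_C hw x).ge) _ hX P
    _ ≤ w ((eval₂ C (fun j => X j - 1) P).coeff (e β)) + (e β).degree • (0 : RInf) :=
      gaussVal_le hw _ _
    _ = w (f β) := by rw [heval, hcoeff, smul_zero, add_zero]

end Torus

section Coaction

open MvPolynomial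

variable {K ι M : Type*} [Field K] [Fintype M] (a : ι → M → ℤ) (I : Ideal (MvPolynomial ι K))

/-- The torus coaction `x_i ↦ x̄_i t^{a_i}` on the polynomial ring. -/
def coactionAux : MvPolynomial ι K →+* TorusRing M (MvPolynomial ι K ⧸ I) :=
  eval₂Hom ((algebraMap (MvPolynomial M (MvPolynomial ι K ⧸ I)) _).comp
    ((C (σ := M)).comp ((Ideal.Quotient.mk I).comp C))) fun i =>
      torusTerm (Ideal.Quotient.mk I (X i)) (a i)

theorem coactionAux_monomial (α : ι →₀ ℕ) (c : K) :
    coactionAux a I (monomial α c) =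
      torusTerm (Ideal.Quotient.mk I (monomial α c)) (wt a α) := by
  rw [coactionAux, coe_eval₂Hom, eval₂_monomial, torusTerm, torusChar_wt, monomial_eq]
  simp only [torusTerm, Finsupp.prod, mul_pow, Finset.prod_mul_distrib, Units.coe_prod,
    Units.val_pow_eq_pow_val, map_mul, map_prod, map_pow, RingHom.comp_apply, mul_assoc]

theorem coactionAux_eq_sum (F : MvPolynomial ι K) :
    coactionAux a I F = ∑ β ∈ F.support.image (wt a),
      torusTerm (Ideal.Quotient.mk I (wtComp a F β)) β := by
  conv_lhs => rw [F.as_sum]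
  rw [map_sum, ← Finset.sum_fiberwise_of_maps_to fun α => Finset.mem_image_of_mem (wt a)]
  refine Finset.sum_congr rfl fun β _ => ?_
  rw [wtComp, torusTerm, map_sum, map_sum, map_sum, Finset.sum_mul]
  refine Finset.sum_congr rfl fun α hα => ?_
  rw [coactionAux_monomial, (Finset.mem_filter.1 hα).2, torusTerm]

theorem torusCounit_coactionAux (F : MvPolynomial ι K) :
    torusCounit (coactionAux a I F) = Ideal.Quotient.mk I F := by
  have : (torusCounit).comp (coactionAux a I) = Ideal.Quotient.mk I := by
    refine MvPolynomial.ringHom_ext (fun c => ?_) fun i => ?_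
    · simp [coactionAux, torusCounit_algebraMap]
    · simp [coactionAux, torusTerm, torusCounit_algebraMap, torusCounit_torusChar]
  exact RingHom.congr_fun this F

variable {a I}

theorem coactionAux_eq_zero (hI : WtHomog a I) (F : MvPolynomial ι K) (hF : F ∈ I) :
    coactionAux a I F = 0 := by
  rw [coactionAux_eq_sum]
  refine Finset.sum_eq_zero fun β _ => ?_
  rw [Ideal.Quotient.eq_zero_iff_mem.2 (hI F hF β), torusTerm, map_zero, map_zero, zero_mul]

/-- The torus coaction on the quotient by a weight-homogeneous ideal. -/
def coaction (hI : WtHomog a I) :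
    MvPolynomial ι K ⧸ I →+* TorusRing M (MvPolynomial ι K ⧸ I) :=
  Ideal.Quotient.lift I (coactionAux a I) (coactionAux_eq_zero hI)

theorem coaction_mk (hI : WtHomog a I) (F : MvPolynomial ι K) :
    coaction hI (Ideal.Quotient.mk I F) = coactionAux a I F :=
  Ideal.Quotient.lift_mk _ _ _

theorem torusCounit_coaction (hI : WtHomog a I) (f : MvPolynomial ι K ⧸ I) :
    torusCounit (coaction hI f) = f := by
  obtain ⟨F, rfl⟩ := Ideal.Quotient.mk_surjective f
  rw [coaction_mk, torusCounit_coactionAux]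

theorem muAux_zero (w : (MvPolynomial ι K ⧸ I) → RInf) (F : MvPolynomial ι K) :
    muAux a I w 0 F =
      (F.support.image (wt a)).inf fun β => w (Ideal.Quotient.mk I (wtComp a F β)) := by
  simp [muAux, pairR]

/-- The translate of `w` by the Gauss point of radius `exp (-s)` around the unit of the torus. -/
def torusTranslate (hI : WtHomog a I) (w : (MvPolynomial ι K ⧸ I) → RInf) (s : RInf) :
    (MvPolynomial ι K ⧸ I) → RInf :=
  fun f => torusVal w s (coaction hI f)

theorem continuous_torusTranslate (hI : WtHomog a I) {T : Type*} [TopologicalSpace T]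
    {w : T → (MvPolynomial ι K ⧸ I) → RInf} {s : T → RInf} (hw : Continuous w)
    (hs : Continuous s) : Continuous fun x => torusTranslate hI (w x) (s x) :=
  continuous_pi fun _ => continuous_inf_RInf _ fun _ _ =>
    ((continuous_apply _).comp hw).add (hs.nsmul _)

variable [LinearOrder M] {w : (MvPolynomial ι K ⧸ I) → RInf} {s : RInf} (hI : WtHomog a I)

theorem torusTranslate_mem_An {v : K → RInf} (hw : w ∈ An v (MvPolynomial ι K ⧸ I)) (hs : 0 ≤ s) :
    torusTranslate hI w s ∈ An v (MvPolynomial ι K ⧸ I) := by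
  refine ⟨(isVal_torusVal hw.1 hs).comp (coaction hI), fun c => ?_⟩
  have : coaction hI (algebraMap K _ c) =
      algebraMap _ _ (C (σ := M) (algebraMap K (MvPolynomial ι K ⧸ I) c)) := by
    change coaction hI (Ideal.Quotient.mk I (C c)) = _
    rw [coaction_mk, coactionAux, coe_eval₂Hom, eval₂_C]
    rfl
  rw [torusTranslate, this, torusVal_algebraMap hw.1 hs, gaussVal_C hw.1, hw.2]

theorem torusTranslate_le (hw : IsVal w) (f : MvPolynomial ι K ⧸ I) :
    torusTranslate hI w s f ≤ w f :=
  (torusVal_le_counit hw _).trans_eq (by rw [torusCounit_coaction])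

theorem torusTranslate_top (hw : IsVal w) : torusTranslate hI w ⊤ = w :=
  funext fun f => (torusVal_top hw _).trans (by rw [torusCounit_coaction])

theorem mu_zero_le_torusTranslate (hw : IsVal w) (hs : 0 ≤ s) (f : MvPolynomial ι K ⧸ I) :
    mu a I 0 w f ≤ torusTranslate hI w s f := by
  conv_rhs => rw [← Function.surjInv_eq Ideal.Quotient.mk_surjective f]
  have hV := isVal_torusVal (M := M) hw hs
  rw [mu, muAux_zero, torusTranslate, coaction_mk, coactionAux_eq_sum]
  refine hV.le_sum fun β hβ => ?_
  rw [torusTerm, hV.map_mul, torusVal_torusChar hw hs, add_zero, torusVal_algebraMap hw hs,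
    gaussVal_C hw]
  exact Finset.inf_le (f := fun β => w (Ideal.Quotient.mk I (wtComp a _ β))) hβ

theorem torusTranslate_zero (hw : IsVal w) : torusTranslate hI w 0 = mu a I 0 w := by
  funext f
  refine le_antisymm ?_ (mu_zero_le_torusTranslate hI hw le_rfl f)
  conv_lhs => rw [← Function.surjInv_eq Ideal.Quotient.mk_surjective f]
  rw [mu, muAux_zero, torusTranslate, coaction_mk, coactionAux_eq_sum]
  exact Finset.le_inf fun β hβ => torusVal_zero_sum_le hw _
    (fun β => Ideal.Quotient.mk I (wtComp a _ β)) hβ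

theorem torusTranslate_eq_self (hw : IsVal w) (hs : 0 ≤ s) (h : mu a I 0 w = w) :
    torusTranslate hI w s = w :=
  funext fun f => le_antisymm (torusTranslate_le hI hw f)
    (by simpa [h] using mu_zero_le_torusTranslate hI hw hs f)

end Coaction

end

/-- `Z = {w ∈ X^an : μ(0,w) = w}` is a strong deformation retract of
`X^an`: there is a continuous `H : X^an × [0,1] → X^an` with `H(w,1) = w`,
`H(w,0) = μ(0,w)`, and `H(w,r) = w` for all `w ∈ Z` and `r ∈ [0,1]`. -/
theorem Z_strong_deformation_retract
    {K : Type*} [Field K] (v : K → RInf) (hv : IsVal v)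
    {n m : ℕ} (a : Fin n → Fin m → ℤ)
    (J : Ideal (MvPolynomial (Fin n) K)) (hJ : WtHomog a J) :
    ∃ H : {w : (MvPolynomial (Fin n) K ⧸ J) → RInf //
            w ∈ An v (MvPolynomial (Fin n) K ⧸ J)} × unitInterval →
          {w : (MvPolynomial (Fin n) K ⧸ J) → RInf //
            w ∈ An v (MvPolynomial (Fin n) K ⧸ J)},
      Continuous H ∧
      (∀ w, (H (w, 1)).val = w.val) ∧
      (∀ w, (H (w, 0)).val = mu a J 0 w.val) ∧
      (∀ w, mu a J 0 w.val = w.val → ∀ r : unitInterval, (H (w, r)).val = w.val) := by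
  obtain ⟨σ, hσ, hσ0, hσ1, hσn⟩ := exists_continuous_RInf
  refine ⟨fun p => ⟨torusTranslate hJ p.1.val (σ p.2), torusTranslate_mem_An hJ p.1.2 (hσn _)⟩, ?_,
    fun w => ?_, fun w => ?_, fun w hw r => ?_⟩
  · exact (continuous_torusTranslate hJ (continuous_subtype_val.comp continuous_fst)
      (hσ.comp continuous_snd)).subtype_mk _
  · simp only [hσ1, torusTranslate_top hJ w.2.1]
  · simp only [hσ0, torusTranslate_zero hJ w.2.1]
  · exact torusTranslate_eq_self hJ w.2.1 (hσn r) hw
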